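/- If u_1, u_2 ∈ H^1(ℝ_+^{n+1}) with n ≥ 1, then for every j ∈ {2, …, n+1}, the boundary integral |∫_{ℝ^n} u_1(0, y') ∂u_2/∂y_j(0, y') dy'| ≤ ‖u_1‖_{H^1(ℝ_+^{n+1})} ‖u_2‖_{H^1(ℝ_+^{n+1})}. -/

import Mathlib

open MeasureTheory
open scoped BigOperators

/-- The open half space `{y ∈ ℝ × ℝⁿ : y₁ > 0}`. -/
def halfSpace (n : ℕ) : Set (ℝ × EuclideanSpace ℝ (Fin n)) := {y | 0 < y.1}

/-- Squared Euclidean norm of the full gradient of `u`. -/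
noncomputable def gradNormSq {n : ℕ} (u : ℝ × EuclideanSpace ℝ (Fin n) → ℝ)
    (y : ℝ × EuclideanSpace ℝ (Fin n)) : ℝ :=
  (fderiv ℝ u y (1, 0)) ^ 2 +
    ∑ i : Fin n, (fderiv ℝ u y ((0 : ℝ), EuclideanSpace.single i 1)) ^ 2

/-- The `H¹(ℝ₊^{n+1})` norm, `(‖u‖²_{L²} + ‖∇u‖²_{L²})^{1/2}`. -/
noncomputable def H1norm {n : ℕ} (u : ℝ × EuclideanSpace ℝ (Fin n) → ℝ) : ℝ :=
  Real.sqrt ((∫ y in halfSpace n, (u y) ^ 2) + ∫ y in halfSpace n, gradNormSq u y)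

open Set Filter Topology

/-- Fubini and the fundamental theorem of calculus for a weighted increment. -/
theorem integral_mul_increment_eq {X : Type*} [MeasurableSpace X] {μ : Measure X} [SFinite μ]
    {p : X → ℝ} {f f' : X → ℝ → ℝ} (hf : ∀ x s, HasDerivAt (f x) (f' x s) s) {h : ℝ}
    (hint : Integrable (fun a : ℝ × X => p a.2 * f' a.2 a.1)
      ((volume.restrict (uIoc 0 h)).prod μ)) :
    ∫ x, p x * (f x h - f x 0) ∂μ = ∫ s in (0 : ℝ)..h, ∫ x, p x * f' x s ∂μ := by
  rw [intervalIntegral_integral_swap (f := fun s x => p x * f' x s) hint]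
  refine integral_congr_ae ?_
  filter_upwards [hint.prod_left_ae] with x hx
  rw [intervalIntegral.integral_eq_sub_of_hasDerivAt (f := fun s => p x * f x s)
    (fun s _ => (hf x s).const_mul (p x)) (intervalIntegrable_iff.2 hx)]
  ring

theorem abs_integral_mul_le_weighted {X : Type*} [MeasurableSpace X] {μ : Measure X}
    {p q : X → ℝ} (hp : MemLp p 2 μ) (hq : MemLp q 2 μ) {c : ℝ} (hc : 0 < c) :
    |∫ x, p x * q x ∂μ| ≤ (c * ∫ x, p x ^ 2 ∂μ + c⁻¹ * ∫ x, q x ^ 2 ∂μ) / 2 := by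
  rw [← integral_const_mul, ← integral_const_mul,
    ← integral_add (hp.integrable_sq.const_mul c) (hq.integrable_sq.const_mul c⁻¹),
    ← integral_div]
  refine norm_integral_le_of_norm_le (f := fun x => p x * q x)
    (((hp.integrable_sq.const_mul c).add (hq.integrable_sq.const_mul c⁻¹)).div_const 2)
    (ae_of_all _ fun x => ?_)
  have key : ∀ a b : ℝ, 0 ≤ a → 0 ≤ b → a * b ≤ (c * a ^ 2 + c⁻¹ * b ^ 2) / 2 := by
    intro a b _ _
    have : c * a ^ 2 + c⁻¹ * b ^ 2 - 2 * (a * b) = c⁻¹ * (c * a - b) ^ 2 := by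
      field_simp
      ring
    have : 0 ≤ c⁻¹ * (c * a - b) ^ 2 := by positivity
    linarith
  simpa [abs_mul] using key |p x| |q x| (abs_nonneg _) (abs_nonneg _)

section HalfSpace

variable {E : Type*} [NormedAddCommGroup E] [NormedSpace ℝ E] [FiniteDimensional ℝ E]
  [MeasurableSpace E] [BorelSpace E] {ν : Measure E} [ν.IsAddHaarMeasure] {e : E}

theorem measurePreserving_tangential_shift (ρ : Measure ℝ) [SFinite ρ] (v : E) :
    MeasurePreserving (fun z : ℝ × E => (z.1, z.2 + v)) (ρ.prod ν) (ρ.prod ν) :=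
  (MeasurePreserving.id ρ).prod (measurePreserving_add_right ν v)

theorem integrable_mul_tangential_shift {ρ : Measure ℝ} [SFinite ρ] {p q : ℝ × E → ℝ}
    (hp : MemLp p 2 (ρ.prod ν)) (hq : MemLp q 2 (ρ.prod ν)) (h : ℝ) :
    Integrable (fun a : ℝ × (ℝ × E) => p a.2 * q (a.2.1, a.2.2 + a.1 • e))
      ((volume.restrict (uIoc 0 h)).prod (ρ.prod ν)) := by
  have : IsFiniteMeasure (volume.restrict (uIoc (0 : ℝ) h)) :=
    ⟨by simp [uIoc]⟩
  have hmp : MeasurePreserving (fun a : ℝ × (ℝ × E) => (a.1, (a.2.1, a.2.2 + a.1 • e)))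
      ((volume.restrict (uIoc 0 h)).prod (ρ.prod ν))
      ((volume.restrict (uIoc 0 h)).prod (ρ.prod ν)) :=
    (MeasurePreserving.id _).skew_product
      (g := fun (s : ℝ) (z : ℝ × E) => (z.1, z.2 + s • e)) (by fun_prop)
      (ae_of_all _ fun s => (measurePreserving_tangential_shift ρ (s • e)).map_eq)
  exact (hp.comp_snd _).integrable_mul ((hq.comp_snd _).comp_measurePreserving hmp)

theorem abs_integral_mul_tangential_increment_le {ρ : Measure ℝ} [SFinite ρ]
    {p f f' : ℝ × E → ℝ}
    (hf : ∀ t y s, HasDerivAt (fun s : ℝ => f (t, y + s • e)) (f' (t, y + s • e)) s)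
    (hp : MemLp p 2 (ρ.prod ν)) (hf' : MemLp f' 2 (ρ.prod ν)) {c : ℝ} (hc : 0 < c) (h : ℝ) :
    |∫ z, p z * (f (z.1, z.2 + h • e) - f z) ∂(ρ.prod ν)| ≤
      (c * ∫ z, p z ^ 2 ∂(ρ.prod ν) + c⁻¹ * ∫ z, f' z ^ 2 ∂(ρ.prod ν)) / 2 * |h| := by
  have key := integral_mul_increment_eq (μ := ρ.prod ν) (p := p)
    (f := fun z s => f (z.1, z.2 + s • e)) (f' := fun z s => f' (z.1, z.2 + s • e))
    (fun z s => hf z.1 z.2 s) (integrable_mul_tangential_shift hp hf' h)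
  simp only [zero_smul, add_zero, Prod.mk.eta] at key
  rw [key]
  have hb := intervalIntegral.norm_integral_le_of_norm_le_const (a := 0) (b := h)
    (f := fun s : ℝ => ∫ z, p z * f' (z.1, z.2 + s • e) ∂(ρ.prod ν))
    (C := (c * ∫ z, p z ^ 2 ∂(ρ.prod ν) + c⁻¹ * ∫ z, f' z ^ 2 ∂(ρ.prod ν)) / 2) ?_
  · simpa using hb
  intro s _
  have hmp := measurePreserving_tangential_shift (ν := ν) ρ (s • e)
  have hsq : ∫ z, f' (z.1, z.2 + s • e) ^ 2 ∂(ρ.prod ν) = ∫ z, f' z ^ 2 ∂(ρ.prod ν) := by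
    conv_rhs => rw [← hmp.map_eq]
    rw [integral_map hmp.measurable.aemeasurable]
    rw [hmp.map_eq]
    exact hf'.aestronglyMeasurable.pow 2
  have := abs_integral_mul_le_weighted hp (hf'.comp_measurePreserving hmp) hc
  simp only [Function.comp_def, hsq] at this
  exact this

/-- The trace estimate with the tangential derivative replaced by a difference. -/
theorem abs_integral_boundary_increment_le {W W₁ W₂ U U₁ U₂ : ℝ × E → ℝ}
    (hW₁ : ∀ t y, HasDerivAt (fun t => W (t, y)) (W₁ (t, y)) t)
    (hW₂ : ∀ t y s, HasDerivAt (fun s : ℝ => W (t, y + s • e)) (W₂ (t, y + s • e)) s)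
    (hU₁ : ∀ t y, HasDerivAt (fun t => U (t, y)) (U₁ (t, y)) t)
    (hU₂ : ∀ t y s, HasDerivAt (fun s : ℝ => U (t, y + s • e)) (U₂ (t, y + s • e)) s)
    (mW : MemLp W 2 ((volume.restrict (Ioi 0)).prod ν))
    (mW₁ : MemLp W₁ 2 ((volume.restrict (Ioi 0)).prod ν))
    (mW₂ : MemLp W₂ 2 ((volume.restrict (Ioi 0)).prod ν))
    (mU : MemLp U 2 ((volume.restrict (Ioi 0)).prod ν))
    (mU₁ : MemLp U₁ 2 ((volume.restrict (Ioi 0)).prod ν))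
    (mU₂ : MemLp U₂ 2 ((volume.restrict (Ioi 0)).prod ν)) {c : ℝ} (hc : 0 < c) (h : ℝ) :
    |∫ y, W (0, y) * (U (0, y + h • e) - U (0, y)) ∂ν| ≤
      (c * (∫ z, W₁ z ^ 2 ∂((volume.restrict (Ioi 0)).prod ν) +
          ∫ z, W₂ z ^ 2 ∂((volume.restrict (Ioi 0)).prod ν)) +
        c⁻¹ * (∫ z, U₁ z ^ 2 ∂((volume.restrict (Ioi 0)).prod ν) +
          ∫ z, U₂ z ^ 2 ∂((volume.restrict (Ioi 0)).prod ν))) / 2 * |h| := by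
  set P : Measure (ℝ × E) := (volume.restrict (Ioi (0 : ℝ))).prod ν with hP
  have hmp : ∀ v : E, MeasurePreserving (fun z : ℝ × E => (z.1, z.2 + v)) P P :=
    measurePreserving_tangential_shift _
  have mD : MemLp (fun z : ℝ × E => U (z.1, z.2 + h • e) - U z) 2 P :=
    (mU.comp_measurePreserving (hmp (h • e))).sub mU
  have mU₁s : MemLp (fun z : ℝ × E => U₁ (z.1, z.2 + h • e)) 2 P :=
    mU₁.comp_measurePreserving (hmp (h • e))
  have mWs : MemLp (fun z : ℝ × E => W (z.1, z.2 + (-h) • e)) 2 P :=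
    mW.comp_measurePreserving (hmp ((-h) • e))
  have i₀ : Integrable (fun z : ℝ × E => W z * (U (z.1, z.2 + h • e) - U z)) P :=
    mW.integrable_mul mD
  have i₁ : Integrable (fun z : ℝ × E => W₁ z * (U (z.1, z.2 + h • e) - U z)) P :=
    mW₁.integrable_mul mD
  have i₂ : Integrable (fun z : ℝ × E => W z * U₁ (z.1, z.2 + h • e)) P :=
    mW.integrable_mul mU₁s
  have i₃ : Integrable (fun z : ℝ × E => W z * U₁ z) P := mW.integrable_mul mU₁
  have i₄ : Integrable (fun z : ℝ × E => U₁ z * W (z.1, z.2 + (-h) • e)) P :=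
    mU₁.integrable_mul mWs
  have i₅ : Integrable (fun z : ℝ × E => U₁ z * W z) P := mU₁.integrable_mul mW
  have idiff : Integrable (fun z : ℝ × E => W₁ z * (U (z.1, z.2 + h • e) - U z) +
      (W z * U₁ (z.1, z.2 + h • e) - W z * U₁ z)) P := i₁.add (i₂.sub i₃)
  have hboundary : ∫ y, W (0, y) * (U (0, y + h • e) - U (0, y)) ∂ν =
      -∫ z, (W₁ z * (U (z.1, z.2 + h • e) - U z) +
        (W z * U₁ (z.1, z.2 + h • e) - W z * U₁ z)) ∂P := by
    rw [integral_prod_symm _ idiff, ← integral_neg]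
    refine integral_congr_ae ?_
    filter_upwards [i₀.prod_left_ae, idiff.prod_left_ae] with y hy hy'
    have hd : ∀ t, HasDerivAt (fun t => W (t, y) * (U (t, y + h • e) - U (t, y)))
        (W₁ (t, y) * (U (t, y + h • e) - U (t, y)) +
          (W (t, y) * U₁ (t, y + h • e) - W (t, y) * U₁ (t, y))) t := by
      intro t
      have := (hW₁ t y).mul ((hU₁ t (y + h • e)).sub (hU₁ t y))
      rwa [mul_sub (W (t, y))] at this
    have := integral_Ioi_of_hasDerivAt_of_tendsto (a := 0) (hd 0).continuousAt.continuousWithinAt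
      (fun t _ => hd t) hy'
      (tendsto_zero_of_hasDerivAt_of_integrableOn_Ioi (fun t _ => hd t) hy' hy)
    rw [this]
    ring
  have hshift : ∫ z, W z * U₁ (z.1, z.2 + h • e) ∂P =
      ∫ z, U₁ z * W (z.1, z.2 + (-h) • e) ∂P := by
    conv_rhs => rw [← (hmp (h • e)).map_eq]
    rw [integral_map (hmp (h • e)).measurable.aemeasurable]
    · refine integral_congr_ae (ae_of_all _ fun z => ?_)
      simp [mul_comm]
    · rw [(hmp (h • e)).map_eq]
      exact i₄.aestronglyMeasurable
  have hsplit : ∫ z, (W₁ z * (U (z.1, z.2 + h • e) - U z) +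
        (W z * U₁ (z.1, z.2 + h • e) - W z * U₁ z)) ∂P =
      ∫ z, W₁ z * (U (z.1, z.2 + h • e) - U z) ∂P +
        ∫ z, U₁ z * (W (z.1, z.2 + (-h) • e) - W z) ∂P := by
    have hadd := integral_add i₁ (i₂.sub i₃)
    have hsub := integral_sub i₂ i₃
    have hsub' := integral_sub i₄ i₅
    simp only [Pi.sub_apply, ← mul_sub] at hadd hsub hsub' ⊢
    rw [hadd, hsub, hshift, hsub']
    simp only [mul_comm (W _) (U₁ _)]
  rw [hboundary, hsplit, abs_neg]
  have b₁ := abs_integral_mul_tangential_increment_le hU₂ mW₁ mU₂ hc h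
  have b₂ := abs_integral_mul_tangential_increment_le hW₂ mU₁ mW₂ (inv_pos.2 hc) (-h)
  rw [inv_inv, abs_neg] at b₂
  refine (abs_add_le _ _).trans ((add_le_add b₁ b₂).trans_eq ?_)
  ring

end HalfSpace

section Limit

variable {E : Type*} [NormedAddCommGroup E] [NormedSpace ℝ E] [FiniteDimensional ℝ E]
  [MeasurableSpace E] [BorelSpace E] {ν : Measure E} [ν.IsAddHaarMeasure] {e : E}

/-- If `w` is supported where `a ≠ 0`, bounds on increments of `v` weighted by `w` pass to its
derivative `g`, provided `a * g` is integrable. -/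
theorem abs_integral_mul_deriv_le_of_increment_le {w v g a : E → ℝ} (hw : Continuous w)
    (hws : HasCompactSupport w)
    (hv : ∀ y s, HasDerivAt (fun s : ℝ => v (y + s • e)) (g (y + s • e)) s)
    (ha : Continuous a) (hne : ∀ y ∈ tsupport w, a y ≠ 0)
    (hag : Integrable (fun y => a y * g y) ν) {M : ℝ} (hM₀ : 0 ≤ M)
    (hM : ∀ h : ℝ, |∫ y, w y * (v (y + h • e) - v y) ∂ν| ≤ M * |h|) :
    |∫ y, w y * g y ∂ν| ≤ M := by
  obtain ⟨δ, hδ, hKU⟩ := hws.isCompact.exists_cthickening_subset_open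
    (isOpen_ne_fun ha continuous_const) hne
  set K := Metric.cthickening δ (tsupport w)
  have hK : IsCompact K := hws.isCompact.cthickening
  have hgK : IntegrableOn g K ν := by
    have h₁ : IntegrableOn (fun y => (a y)⁻¹ * (a y * g y)) K ν :=
      hag.integrableOn.continuousOn_mul (ha.continuousOn.inv₀ fun y hy => hKU hy) hK
    refine h₁.congr_fun (fun y hy => ?_) hK.measurableSet
    exact inv_mul_cancel_left₀ (hKU hy) _
  set G := K.indicator g
  have hG : Integrable G ν := hgK.integrable_indicator hK.measurableSet
  have hwG : ∀ y, ∀ s : ℝ, ‖s • e‖ ≤ δ → w y * g (y + s • e) = w y * G (y + s • e) := by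
    intro y s hs
    by_cases hy : y ∈ tsupport w
    · have : y + s • e ∈ K := by
        refine Metric.mem_cthickening_of_dist_le _ y _ _ hy ?_
        simpa [dist_eq_norm] using hs
      simp [G, indicator_of_mem this]
    · simp [image_eq_zero_of_notMem_tsupport hy]
  obtain ⟨B, hB⟩ := hws.exists_bound_of_continuous hw
  set F : ℝ → ℝ := fun s => ∫ y, w y * G (y + s • e) ∂ν with hF
  have hF' : ∀ s, F s = ∫ y, w (y - s • e) * G y ∂ν := by
    intro s
    rw [hF]
    simpa using integral_add_right_eq_self (μ := ν) (fun y => w (y - s • e) * G y) (s • e)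
  have hFc : Continuous F := by
    rw [funext hF']
    refine continuous_of_dominated (bound := fun y => B * ‖G y‖) (fun s => ?_) (fun s => ?_)
      (hG.norm.const_mul B) (ae_of_all _ fun y => ?_)
    · exact (Continuous.aestronglyMeasurable (by fun_prop)).mul hG.aestronglyMeasurable
    · refine ae_of_all _ fun y => ?_
      rw [norm_mul]
      exact mul_le_mul_of_nonneg_right (hB _) (norm_nonneg _)
    · fun_prop
  have hF₀ : ∫ y, w y * g y ∂ν = F 0 := by
    refine integral_congr_ae (ae_of_all _ fun y => ?_)
    simpa using hwG y 0 (by simpa using hδ.le)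
  have hderiv : HasDerivAt (fun h => ∫ s in (0 : ℝ)..h, F s) (F 0) 0 :=
    intervalIntegral.integral_hasDerivAt_right (hFc.intervalIntegrable _ _)
      (hFc.stronglyMeasurableAtFilter _ _) hFc.continuousAt
  rw [hF₀]
  refine hderiv.le_of_lip' hM₀ ?_
  have hsmall : ∀ᶠ h : ℝ in 𝓝 0, |h| * ‖e‖ < δ := by
    have : Tendsto (fun h : ℝ => |h| * ‖e‖) (𝓝 0) (𝓝 (|(0 : ℝ)| * ‖e‖)) :=
      Continuous.tendsto (by fun_prop) 0
    exact this.eventually_lt_const (by simpa using hδ)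
  filter_upwards [hsmall] with h hh
  have hle : ∀ s ∈ uIoc 0 h, ‖s • e‖ ≤ δ := by
    intro s hs
    rw [norm_smul, Real.norm_eq_abs]
    have : |s| ≤ |h| := by
      have := abs_sub_left_of_mem_uIcc (uIoc_subset_uIcc hs)
      simpa using this
    exact (mul_le_mul_of_nonneg_right this (norm_nonneg _)).trans hh.le
  have hjoint : Integrable (fun x : ℝ × E => w x.2 * G (x.2 + x.1 • e))
      ((volume.restrict (uIoc 0 h)).prod ν) := by
    have : IsFiniteMeasure (volume.restrict (uIoc (0 : ℝ) h)) := ⟨by simp [uIoc]⟩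
    have hmp : MeasurePreserving (fun x : ℝ × E => (x.1, x.2 + x.1 • e))
        ((volume.restrict (uIoc 0 h)).prod ν) ((volume.restrict (uIoc 0 h)).prod ν) :=
      (MeasurePreserving.id _).skew_product (g := fun (s : ℝ) (y : E) => y + s • e)
        (by fun_prop) (ae_of_all _ fun s => (measurePreserving_add_right ν (s • e)).map_eq)
    have h₁ : Integrable (fun x : ℝ × E => G (x.2 + x.1 • e))
        ((volume.restrict (uIoc 0 h)).prod ν) :=
      hmp.integrable_comp_of_integrable (hG.comp_snd (volume.restrict (uIoc 0 h)))
    exact h₁.bdd_mul (c := B) (Continuous.aestronglyMeasurable (by fun_prop))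
      (ae_of_all _ fun x => hB _)
  have hjoint' : Integrable (fun x : ℝ × E => w x.2 * g (x.2 + x.1 • e))
      ((volume.restrict (uIoc 0 h)).prod ν) := by
    refine hjoint.congr ?_
    have hmem : ∀ᵐ x ∂((volume.restrict (uIoc 0 h)).prod ν), x.1 ∈ uIoc 0 h :=
      Measure.quasiMeasurePreserving_fst.ae (ae_restrict_mem measurableSet_uIoc)
    filter_upwards [hmem] with x hx using (hwG x.2 x.1 (hle _ hx)).symm
  have key := integral_mul_increment_eq (μ := ν) (p := w) (f := fun y s => v (y + s • e))
    (f' := fun y s => g (y + s • e)) hv hjoint'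
  have hFint : ∫ s in (0 : ℝ)..h, F s = ∫ y, w y * (v (y + h • e) - v y) ∂ν := by
    simp only [zero_smul, add_zero] at key
    rw [key]
    refine intervalIntegral.integral_congr_ae (ae_of_all _ fun s hs => ?_)
    exact integral_congr_ae (ae_of_all _ fun y => (hwG y s (hle s hs)).symm)
  simpa [hFint] using hM h

theorem exists_smooth_cutoffs (E : Type*) [NormedAddCommGroup E] [NormedSpace ℝ E]
    [FiniteDimensional ℝ E] :
    ∃ (χ : ℕ → E → ℝ) (δ : ℕ → ℝ), (∀ k, ContDiff ℝ 1 (χ k)) ∧ (∀ k, HasCompactSupport (χ k)) ∧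
      (∀ k y, |χ k y| ≤ 1) ∧ (∀ k y, ‖fderiv ℝ (χ k) y‖ ≤ δ k) ∧
      (∀ y, ∀ᶠ k in atTop, χ k y = 1) ∧ Tendsto δ atTop (𝓝 0) := by
  let b : ContDiffBump (0 : E) := ⟨1, 2, one_pos, one_lt_two⟩
  have hb : ContDiff ℝ 1 b := b.contDiff
  obtain ⟨C, hC⟩ := (b.hasCompactSupport.fderiv ℝ).exists_bound_of_continuous
    (hb.continuous_fderiv one_ne_zero)
  have hpos : ∀ k : ℕ, (0 : ℝ) < ((k : ℝ) + 1)⁻¹ := fun k => by positivity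
  refine ⟨fun k y => b (((k : ℝ) + 1)⁻¹ • y), fun k => C * ((k : ℝ) + 1)⁻¹, fun k => ?_,
    fun k => ?_, fun k y => ?_, fun k y => ?_, fun y => ?_, ?_⟩
  · exact hb.comp (contDiff_const_smul _)
  · exact b.hasCompactSupport.comp_homeomorph (Homeomorph.smulOfNeZero _ (hpos k).ne')
  · rw [abs_of_nonneg b.nonneg]
    exact b.le_one
  · have hd : HasFDerivAt (fun y : E => b (((k : ℝ) + 1)⁻¹ • y))
        ((fderiv ℝ b (((k : ℝ) + 1)⁻¹ • y)).comp
          (((k : ℝ) + 1)⁻¹ • ContinuousLinearMap.id ℝ E)) y :=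
      ((hb.differentiable one_ne_zero) _).hasFDerivAt.comp y
        ((hasFDerivAt_id y).const_smul ((k : ℝ) + 1)⁻¹)
    rw [hd.fderiv, ContinuousLinearMap.comp_smul, ContinuousLinearMap.comp_id, norm_smul,
      Real.norm_of_nonneg (hpos k).le, mul_comm]
    exact mul_le_mul_of_nonneg_right (hC _) (hpos k).le
  · have : Tendsto (fun k : ℕ => ((k : ℝ) + 1)⁻¹ * ‖y‖) atTop (𝓝 (0 * ‖y‖)) := by
      simpa only [one_div] using tendsto_one_div_add_atTop_nhds_zero_nat.mul_const ‖y‖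
    filter_upwards [this.eventually_le_const (u := 1) (by simp)] with k hk
    refine b.one_of_mem_closedBall ?_
    rw [mem_closedBall_zero_iff, norm_smul, Real.norm_of_nonneg (hpos k).le]
    exact hk
  · simpa only [one_div, mul_zero] using tendsto_one_div_add_atTop_nhds_zero_nat.const_mul C

/-- Differentiable truncations that vanish near the origin and approximate the identity. -/
theorem exists_truncations :
    ∃ φ ψ : ℕ → ℝ → ℝ, (∀ k, Continuous (ψ k)) ∧ (∀ k t, HasDerivAt (φ k) (ψ k t) t) ∧
      (∀ k t, |ψ k t| ≤ 1) ∧ (∀ k t, |φ k t| ≤ |t|) ∧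
      (∀ k, ∃ η > 0, ∀ t, |t| < η → φ k t = 0) ∧
      ∀ t, Tendsto (fun k => φ k t) atTop (𝓝 t) := by
  let ψ : ℕ → ℝ → ℝ := fun k s => max 0 (min 1 ((k + 1) * |s| - 1))
  have hψc : ∀ k, Continuous (ψ k) := fun k => by fun_prop
  have hψ : ∀ k t, |ψ k t| ≤ 1 := fun k t => by
    rw [abs_of_nonneg (le_max_left _ _)]
    exact max_le zero_le_one (min_le_left _ _)
  refine ⟨fun k t => ∫ s in (0 : ℝ)..t, ψ k s, ψ, hψc, fun k t => ?_, hψ, fun k t => ?_,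
    fun k => ⟨((k : ℝ) + 1)⁻¹, by positivity, fun t ht => ?_⟩, fun t => ?_⟩
  · exact intervalIntegral.integral_hasDerivAt_right ((hψc k).intervalIntegrable _ _)
      ((hψc k).stronglyMeasurableAtFilter _ _) (hψc k).continuousAt
  · simpa using intervalIntegral.norm_integral_le_of_norm_le_const (a := 0) (b := t)
      (f := ψ k) (C := 1) (fun s _ => hψ k s)
  · change (∫ s in (0 : ℝ)..t, ψ k s) = 0
    rw [intervalIntegral.integral_congr (g := fun _ => (0 : ℝ)),
      intervalIntegral.integral_zero]
    intro s hs
    have hst : |s| ≤ |t| := by simpa using abs_sub_left_of_mem_uIcc hs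
    have : ((k : ℝ) + 1) * |s| ≤ 1 := by
      have hk : (0 : ℝ) < (k : ℝ) + 1 := by positivity
      calc ((k : ℝ) + 1) * |s| ≤ ((k : ℝ) + 1) * ((k : ℝ) + 1)⁻¹ := by
            gcongr
            exact hst.trans ht.le
        _ = 1 := mul_inv_cancel₀ hk.ne'
    exact max_eq_left ((min_le_right _ _).trans (by linarith))
  · have h₁ : Tendsto (fun k => ∫ s in (0 : ℝ)..t, ψ k s) atTop
        (𝓝 (∫ _ in (0 : ℝ)..t, (1 : ℝ))) := by
      refine intervalIntegral.tendsto_integral_filter_of_dominated_convergence (fun _ => 1)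
        (Eventually.of_forall fun k => (hψc k).aestronglyMeasurable)
        (Eventually.of_forall fun k => ae_of_all _ fun s _ => hψ k s)
        (by simp) ?_
      have hne : ∀ᵐ s : ℝ, s ≠ 0 := by simp [ae_iff]
      filter_upwards [hne] with s hs _
      refine tendsto_const_nhds.congr' ?_
      have : Tendsto (fun k : ℕ => ((k : ℝ) + 1) * |s|) atTop atTop :=
        (tendsto_natCast_atTop_atTop.atTop_add tendsto_const_nhds).atTop_mul_const (abs_pos.2 hs)
      filter_upwards [this.eventually_ge_atTop 2] with k hk
      have : min 1 (((k : ℝ) + 1) * |s| - 1) = 1 := min_eq_left (by linarith)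
      simp [ψ, this]
    simpa using h₁

end Limit

theorem le_sqrt_mul_sqrt_of_forall_weighted {x A B : ℝ} (hx : 0 ≤ x) (hA : 0 ≤ A) (hB : 0 ≤ B)
    (h : ∀ c > 0, x ≤ (c * A + c⁻¹ * B) / 2) : x ≤ √A * √B := by
  rw [← Real.sqrt_mul hA]
  refine Real.le_sqrt_of_sq_le ?_
  have hd : discrim A (-(2 * x)) B ≤ 0 := by
    refine discrim_le_zero fun c => ?_
    rcases le_or_gt c 0 with hc | hc
    · nlinarith [mul_nonneg hA (mul_self_nonneg c), mul_nonneg hx (neg_nonneg.2 hc)]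
    · have := mul_le_mul_of_nonneg_left (h c hc) hc.le
      have hcc : c * ((c * A + c⁻¹ * B) / 2) = (A * (c * c) + B) / 2 := by
        field_simp
      rw [hcc] at this
      linarith
  rw [discrim] at hd
  linarith

theorem volume_restrict_halfSpace (n : ℕ) :
    (volume : Measure (ℝ × EuclideanSpace ℝ (Fin n))).restrict (halfSpace n) =
      (volume.restrict (Ioi 0)).prod volume := by
  have : halfSpace n = Ioi (0 : ℝ) ×ˢ (univ : Set (EuclideanSpace ℝ (Fin n))) := by
    ext y
    simp [halfSpace]
  rw [this, Measure.volume_eq_prod, ← Measure.prod_restrict, Measure.restrict_univ]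

theorem sq_normal_add_sq_tangential_le_gradNormSq {n : ℕ}
    (u : ℝ × EuclideanSpace ℝ (Fin n) → ℝ) (y : ℝ × EuclideanSpace ℝ (Fin n)) (j : Fin n) :
    (fderiv ℝ u y (1, 0)) ^ 2 + (fderiv ℝ u y ((0 : ℝ), EuclideanSpace.single j 1)) ^ 2 ≤
      gradNormSq u y := by
  refine add_le_add_right ?_ _
  exact Finset.single_le_sum
    (f := fun i => (fderiv ℝ u y ((0 : ℝ), EuclideanSpace.single i 1)) ^ 2)
    (fun i _ => sq_nonneg _) (Finset.mem_univ j)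

theorem gradNormSq_nonneg {n : ℕ} (u : ℝ × EuclideanSpace ℝ (Fin n) → ℝ)
    (y : ℝ × EuclideanSpace ℝ (Fin n)) : 0 ≤ gradNormSq u y :=
  add_nonneg (sq_nonneg _) (Finset.sum_nonneg fun _ _ => sq_nonneg _)

section Lines

variable {E : Type*} [NormedAddCommGroup E] [NormedSpace ℝ E]

theorem hasDerivAt_normal_line {u : ℝ × E → ℝ} (hu : Differentiable ℝ u) (t : ℝ) (y : E) :
    HasDerivAt (fun t => u (t, y)) (fderiv ℝ u (t, y) (1, 0)) t :=
  (hu (t, y)).hasFDerivAt.comp_hasDerivAt t ((hasDerivAt_id t).prodMk (hasDerivAt_const t y))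

theorem hasDerivAt_add_smul (y e : E) (s : ℝ) : HasDerivAt (fun s : ℝ => y + s • e) e s := by
  simpa using ((hasDerivAt_id s).smul_const e).const_add y

theorem hasDerivAt_tangential_line {u : ℝ × E → ℝ} (hu : Differentiable ℝ u) (t : ℝ) (y e : E)
    (s : ℝ) :
    HasDerivAt (fun s : ℝ => u (t, y + s • e)) (fderiv ℝ u (t, y + s • e) (0, e)) s :=
  (hu (t, y + s • e)).hasFDerivAt.comp_hasDerivAt s
    ((hasDerivAt_const s t).prodMk (hasDerivAt_add_smul y e s))

end Lines

theorem memLp_two_of_sq_le {X : Type*} [MeasurableSpace X] {μ : Measure X} {f b : X → ℝ}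
    (hf : Measurable f) (hb : Integrable b μ) (hfb : ∀ x, f x ^ 2 ≤ b x) : MemLp f 2 μ := by
  refine (memLp_two_iff_integrable_sq hf.aestronglyMeasurable).2
    (hb.mono' (hf.pow_const 2).aestronglyMeasurable (ae_of_all _ fun x => ?_))
  rw [Real.norm_of_nonneg (sq_nonneg _)]
  exact hfb x

/-- Pointwise energy bound for a product `χ * φ(u)`, where `r`, `m` stand for the values of `χ` and
`φ'(u)`, and `d` for a partial derivative of `χ`. -/
theorem sq_truncated_gradient_le {r m d q a b x δ : ℝ} (hr : |r| ≤ 1) (hm : |m| ≤ 1)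
    (hd : |d| ≤ δ) (hq : |q| ≤ |x|) :
    (r * (m * a)) ^ 2 + (d * q + r * (m * b)) ^ 2 ≤ (1 + δ) ^ 2 * (x ^ 2 + (a ^ 2 + b ^ 2)) := by
  have hδ : 0 ≤ δ := (abs_nonneg d).trans hd
  have hrm : |r * m| ≤ 1 := by
    rw [abs_mul]
    exact mul_le_one₀ hr (abs_nonneg _) hm
  have hdq : |d * q| ≤ δ * |x| := by
    rw [abs_mul]
    exact mul_le_mul hd hq (abs_nonneg _) hδ
  have hscale : ∀ s, |r * (m * s)| ≤ |s| := by
    intro s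
    rw [← mul_assoc, abs_mul]
    exact mul_le_of_le_one_left (abs_nonneg _) hrm
  have h₁ : (r * (m * a)) ^ 2 ≤ a ^ 2 := sq_le_sq.2 (hscale a)
  have h₂ : (d * q + r * (m * b)) ^ 2 ≤ (δ * |x| + |b|) ^ 2 := by
    refine sq_le_sq' ?_ ?_ <;>
      linarith [(abs_le.1 hdq).1, (abs_le.1 (hscale b)).1, (abs_le.1 hdq).2,
        (abs_le.1 (hscale b)).2]
  have h₃ : (δ * |x| + |b|) ^ 2 ≤ (δ + δ ^ 2) * x ^ 2 + (1 + δ) * b ^ 2 := by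
    have hx := sq_abs x
    have hb := sq_abs b
    have := mul_nonneg hδ (sq_nonneg (|x| - |b|))
    nlinarith
  nlinarith [sq_nonneg x, sq_nonneg a, sq_nonneg b, mul_nonneg hδ (sq_nonneg x),
    mul_nonneg hδ (sq_nonneg a), mul_nonneg hδ (sq_nonneg b),
    mul_nonneg (sq_nonneg δ) (sq_nonneg a), mul_nonneg (sq_nonneg δ) (sq_nonneg b)]

/-- The trace estimate for `u₁` replaced by a truncation `χ * φ(u₁)`, with explicit loss `δ`. -/
theorem abs_integral_truncated_trace_le {n : ℕ} {u₁ u₂ : ℝ × EuclideanSpace ℝ (Fin n) → ℝ}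
    (h₁ : Differentiable ℝ u₁) (h₂ : Differentiable ℝ u₂)
    (hu₁ : IntegrableOn (fun y => (u₁ y) ^ 2) (halfSpace n))
    (hg₁ : IntegrableOn (gradNormSq u₁) (halfSpace n))
    (hu₂ : IntegrableOn (fun y => (u₂ y) ^ 2) (halfSpace n))
    (hg₂ : IntegrableOn (gradNormSq u₂) (halfSpace n)) (j : Fin n)
    (hint : Integrable fun y' : EuclideanSpace ℝ (Fin n) =>
      u₁ (0, y') * fderiv ℝ u₂ (0, y') ((0 : ℝ), EuclideanSpace.single j 1))
    {χ : EuclideanSpace ℝ (Fin n) → ℝ} {φ ψ : ℝ → ℝ} {δ η : ℝ} (hχ : ContDiff ℝ 1 χ)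
    (hχs : HasCompactSupport χ) (hχ₁ : ∀ y, |χ y| ≤ 1) (hχδ : ∀ y, ‖fderiv ℝ χ y‖ ≤ δ)
    (hψ : Continuous ψ) (hφ : ∀ t, HasDerivAt φ (ψ t) t) (hψ₁ : ∀ t, |ψ t| ≤ 1)
    (hφ₁ : ∀ t, |φ t| ≤ |t|) (hη : 0 < η) (hφη : ∀ t, |t| < η → φ t = 0) {c : ℝ} (hc : 0 < c) :
    |∫ y' : EuclideanSpace ℝ (Fin n), (χ y' * φ (u₁ (0, y'))) *
        fderiv ℝ u₂ (0, y') ((0 : ℝ), EuclideanSpace.single j 1)| ≤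
      (c * ((1 + δ) ^ 2 *
          ((∫ y in halfSpace n, (u₁ y) ^ 2) + ∫ y in halfSpace n, gradNormSq u₁ y)) +
        c⁻¹ * ((∫ y in halfSpace n, (u₂ y) ^ 2) + ∫ y in halfSpace n, gradNormSq u₂ y)) / 2 := by
  set e : EuclideanSpace ℝ (Fin n) := EuclideanSpace.single j 1
  have he : ‖e‖ = 1 := by simp [e]
  unfold IntegrableOn at hu₁ hg₁ hu₂ hg₂
  rw [volume_restrict_halfSpace] at hu₁ hg₁ hu₂ hg₂ ⊢
  set P : Measure (ℝ × EuclideanSpace ℝ (Fin n)) := (volume.restrict (Ioi (0 : ℝ))).prod volume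
  have hφc : Continuous φ := continuous_iff_continuousAt.2 fun t => (hφ t).continuousAt
  have hu₁c := h₁.continuous
  have hu₂c := h₂.continuous
  have hχc := hχ.continuous
  have hχd : ∀ y, |fderiv ℝ χ y e| ≤ δ := fun y => by
    simpa [he] using ((fderiv ℝ χ y).le_opNorm e).trans
      (mul_le_mul_of_nonneg_right (hχδ y) (norm_nonneg e))
  set W : ℝ × EuclideanSpace ℝ (Fin n) → ℝ := fun z => χ z.2 * φ (u₁ z) with hW
  set W₁ : ℝ × EuclideanSpace ℝ (Fin n) → ℝ :=
    fun z => χ z.2 * (ψ (u₁ z) * fderiv ℝ u₁ z (1, 0)) with hW₁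
  set W₂ : ℝ × EuclideanSpace ℝ (Fin n) → ℝ :=
    fun z => fderiv ℝ χ z.2 e * φ (u₁ z) + χ z.2 * (ψ (u₁ z) * fderiv ℝ u₁ z (0, e)) with hW₂
  have hpt : ∀ z, W₁ z ^ 2 + W₂ z ^ 2 ≤ (1 + δ) ^ 2 * (u₁ z ^ 2 + gradNormSq u₁ z) := fun z =>
    (sq_truncated_gradient_le (hχ₁ z.2) (hψ₁ _) (hχd z.2) (hφ₁ _)).trans
      (mul_le_mul_of_nonneg_left
        (add_le_add_right (sq_normal_add_sq_tangential_le_gradNormSq u₁ z j) _) (sq_nonneg _))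
  have hpt₂ := fun z => sq_normal_add_sq_tangential_le_gradNormSq u₂ z j
  have hχe : Continuous fun y => fderiv ℝ χ y e :=
    (hχ.continuous_fderiv one_ne_zero).clm_apply continuous_const
  have hb₁ : Integrable (fun z => (1 + δ) ^ 2 * (u₁ z ^ 2 + gradNormSq u₁ z)) P :=
    (hu₁.add hg₁).const_mul _
  have mW : MemLp W 2 P := by
    refine memLp_two_of_sq_le (Continuous.measurable (by fun_prop)) hu₁ fun z => ?_
    refine sq_le_sq.2 ?_
    rw [hW, abs_mul]
    exact (mul_le_of_le_one_left (abs_nonneg _) (hχ₁ _)).trans (hφ₁ _)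
  have hχm : Measurable fun z : ℝ × EuclideanSpace ℝ (Fin n) => χ z.2 :=
    Continuous.measurable (by fun_prop)
  have hψm : Measurable fun z => ψ (u₁ z) := Continuous.measurable (by fun_prop)
  have hφm : Measurable fun z => φ (u₁ z) := Continuous.measurable (by fun_prop)
  have hχem : Measurable fun z : ℝ × EuclideanSpace ℝ (Fin n) => fderiv ℝ χ z.2 e :=
    (hχe.comp continuous_snd).measurable
  have mW₁ : MemLp W₁ 2 P :=
    memLp_two_of_sq_le (hχm.mul (hψm.mul (measurable_fderiv_apply_const ℝ u₁ _))) hb₁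
      fun z => (le_add_of_nonneg_right (sq_nonneg _)).trans (hpt z)
  have mW₂ : MemLp W₂ 2 P :=
    memLp_two_of_sq_le ((hχem.mul hφm).add
      (hχm.mul (hψm.mul (measurable_fderiv_apply_const ℝ u₁ _)))) hb₁
      fun z => (le_add_of_nonneg_left (sq_nonneg _)).trans (hpt z)
  have mU : MemLp u₂ 2 P := memLp_two_of_sq_le hu₂c.measurable hu₂ fun z => le_rfl
  have mU₁ : MemLp (fun z => fderiv ℝ u₂ z (1, 0)) 2 P :=
    memLp_two_of_sq_le (measurable_fderiv_apply_const ℝ u₂ _) hg₂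
      fun z => (le_add_of_nonneg_right (sq_nonneg _)).trans (hpt₂ z)
  have mU₂ : MemLp (fun z => fderiv ℝ u₂ z (0, e)) 2 P :=
    memLp_two_of_sq_le (measurable_fderiv_apply_const ℝ u₂ _) hg₂
      fun z => (le_add_of_nonneg_left (sq_nonneg _)).trans (hpt₂ z)
  have dW₁ : ∀ t y, HasDerivAt (fun t => W (t, y)) (W₁ (t, y)) t := fun t y =>
    ((hφ _).comp t (hasDerivAt_normal_line h₁ t y)).const_mul (χ y)
  have dW₂ : ∀ t y s, HasDerivAt (fun s : ℝ => W (t, y + s • e)) (W₂ (t, y + s • e)) s :=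
    fun t y s =>
      (((hχ.differentiable one_ne_zero) (y + s • e)).hasFDerivAt.comp_hasDerivAt s
        (hasDerivAt_add_smul y e s)).mul ((hφ _).comp s (hasDerivAt_tangential_line h₁ t y e s))
  have hincr := fun h => abs_integral_boundary_increment_le dW₁ dW₂ (hasDerivAt_normal_line h₂)
    (fun t y s => hasDerivAt_tangential_line h₂ t y e s) mW mW₁ mW₂ mU mU₁ mU₂ hc h
  have hWint : ∫ z, W₁ z ^ 2 ∂P + ∫ z, W₂ z ^ 2 ∂P ≤
      (1 + δ) ^ 2 * (∫ z, u₁ z ^ 2 ∂P + ∫ z, gradNormSq u₁ z ∂P) := by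
    rw [← integral_add mW₁.integrable_sq mW₂.integrable_sq, ← integral_add hu₁ hg₁,
      ← integral_const_mul]
    exact integral_mono (mW₁.integrable_sq.add mW₂.integrable_sq) hb₁ hpt
  have hUint : ∫ z, (fderiv ℝ u₂ z (1, 0)) ^ 2 ∂P + ∫ z, (fderiv ℝ u₂ z (0, e)) ^ 2 ∂P ≤
      ∫ z, u₂ z ^ 2 ∂P + ∫ z, gradNormSq u₂ z ∂P := by
    rw [← integral_add mU₁.integrable_sq mU₂.integrable_sq]
    exact (integral_mono (mU₁.integrable_sq.add mU₂.integrable_sq) hg₂ hpt₂).trans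
      (le_add_of_nonneg_left (integral_nonneg fun z => sq_nonneg _))
  have hM := add_le_add (mul_le_mul_of_nonneg_left hWint hc.le)
    (mul_le_mul_of_nonneg_left hUint (inv_pos.2 hc).le)
  have hM' := div_le_div_of_nonneg_right hM zero_le_two
  refine le_trans ?_ hM'
  refine abs_integral_mul_deriv_le_of_increment_le (e := e) (v := fun y => u₂ (0, y))
    (a := fun y => u₁ (0, y)) (by fun_prop) hχs.mul_right
    (fun y s => hasDerivAt_tangential_line h₂ 0 y e s) (by fun_prop) ?_ hint ?_ hincr
  · intro y hy h₀
    have hsub : tsupport (fun y => χ y * φ (u₁ (0, y))) ⊆ {y | η ≤ |u₁ (0, y)|} := by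
      refine closure_minimal (fun y hy => ?_) (isClosed_le (by fun_prop) (by fun_prop))
      by_contra hlt
      exact hy (by simp [hφη _ (not_le.1 hlt)])
    have : η ≤ |u₁ (0, y)| := hsub hy
    rw [h₀, abs_zero] at this
    exact hη.not_ge this
  · have hci := inv_pos.2 hc
    have n₁ : 0 ≤ ∫ z, W₁ z ^ 2 ∂P := integral_nonneg fun z => sq_nonneg _
    have n₂ : 0 ≤ ∫ z, W₂ z ^ 2 ∂P := integral_nonneg fun z => sq_nonneg _
    have n₃ : 0 ≤ ∫ z, (fderiv ℝ u₂ z (1, 0)) ^ 2 ∂P := integral_nonneg fun z => sq_nonneg _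
    have n₄ : 0 ≤ ∫ z, (fderiv ℝ u₂ z (0, e)) ^ 2 ∂P := integral_nonneg fun z => sq_nonneg _
    positivity

/-- Trace estimate: for `u₁, u₂ ∈ H¹(ℝ₊^{n+1})` (`n ≥ 1`) and a tangential
direction `j ∈ {2,…,n+1}`,
`|∫_{ℝⁿ} u₁(0,y') ∂u₂/∂y_j(0,y') dy'| ≤ ‖u₁‖_{H¹(ℝ₊^{n+1})} ‖u₂‖_{H¹(ℝ₊^{n+1})}`. -/
theorem boundary_tangential_trace_estimate (n : ℕ) (hn : 1 ≤ n)
    (u₁ u₂ : ℝ × EuclideanSpace ℝ (Fin n) → ℝ)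
    (h₁ : Differentiable ℝ u₁) (h₂ : Differentiable ℝ u₂)
    (hu₁ : IntegrableOn (fun y => (u₁ y) ^ 2) (halfSpace n))
    (hg₁ : IntegrableOn (gradNormSq u₁) (halfSpace n))
    (hu₂ : IntegrableOn (fun y => (u₂ y) ^ 2) (halfSpace n))
    (hg₂ : IntegrableOn (gradNormSq u₂) (halfSpace n))
    (j : Fin n) :
    |∫ y' : EuclideanSpace ℝ (Fin n),
        u₁ (0, y') * fderiv ℝ u₂ (0, y') ((0 : ℝ), EuclideanSpace.single j 1)|
      ≤ H1norm u₁ * H1norm u₂ := by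
  have hN₁ : 0 ≤ (∫ y in halfSpace n, (u₁ y) ^ 2) + ∫ y in halfSpace n, gradNormSq u₁ y :=
    add_nonneg (integral_nonneg fun _ => sq_nonneg _) (integral_nonneg (gradNormSq_nonneg u₁))
  have hN₂ : 0 ≤ (∫ y in halfSpace n, (u₂ y) ^ 2) + ∫ y in halfSpace n, gradNormSq u₂ y :=
    add_nonneg (integral_nonneg fun _ => sq_nonneg _) (integral_nonneg (gradNormSq_nonneg u₂))
  by_cases hint : Integrable fun y' : EuclideanSpace ℝ (Fin n) =>
      u₁ (0, y') * fderiv ℝ u₂ (0, y') ((0 : ℝ), EuclideanSpace.single j 1)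
  swap
  · rw [integral_undef hint, abs_zero]
    exact mul_nonneg (Real.sqrt_nonneg _) (Real.sqrt_nonneg _)
  obtain ⟨χ, δ, hχ, hχs, hχ₁, hχδ, hχlim, hδ⟩ := exists_smooth_cutoffs (EuclideanSpace ℝ (Fin n))
  obtain ⟨φ, ψ, hψ, hφ, hψ₁, hφ₁, hφη, hφlim⟩ := exists_truncations
  have hu₁c := h₁.continuous
  refine le_sqrt_mul_sqrt_of_forall_weighted (abs_nonneg _) hN₁ hN₂ fun c hc => ?_
  have hbound : ∀ k, _ := fun k =>
    have ⟨_, hη, hφ₀⟩ := hφη k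
    abs_integral_truncated_trace_le h₁ h₂ hu₁ hg₁ hu₂ hg₂ j hint (hχ k) (hχs k) (hχ₁ k) (hχδ k)
      (hψ k) (hφ k) (hψ₁ k) (hφ₁ k) hη hφ₀ hc
  have hgm : Measurable fun y' : EuclideanSpace ℝ (Fin n) =>
      fderiv ℝ u₂ (0, y') ((0 : ℝ), EuclideanSpace.single j 1) :=
    (measurable_fderiv_apply_const ℝ u₂ _).comp (by fun_prop)
  have hlim : Tendsto (fun k => ∫ y' : EuclideanSpace ℝ (Fin n), (χ k y' * φ k (u₁ (0, y'))) *
      fderiv ℝ u₂ (0, y') ((0 : ℝ), EuclideanSpace.single j 1)) atTop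
      (𝓝 (∫ y' : EuclideanSpace ℝ (Fin n),
        u₁ (0, y') * fderiv ℝ u₂ (0, y') ((0 : ℝ), EuclideanSpace.single j 1))) := by
    refine tendsto_integral_of_dominated_convergence _ (fun k => ?_) hint.norm (fun k => ?_) ?_
    · have hφc : Continuous (φ k) := continuous_iff_continuousAt.2 fun t => (hφ k t).continuousAt
      have hχc := (hχ k).continuous
      exact ((Continuous.measurable (by fun_prop)).mul hgm).aestronglyMeasurable
    · refine ae_of_all _ fun y => ?_
      rw [norm_mul, norm_mul, norm_mul]
      exact mul_le_mul_of_nonneg_right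
        ((mul_le_of_le_one_left (norm_nonneg _) (hχ₁ k y)).trans (hφ₁ k _)) (norm_nonneg _)
    · refine ae_of_all _ fun y => Tendsto.mul_const _ ?_
      refine (hφlim (u₁ (0, y))).congr' ?_
      filter_upwards [hχlim y] with k hk
      rw [hk, one_mul]
  refine le_of_tendsto_of_tendsto' hlim.abs ?_ hbound
  have hδ' : Tendsto (fun k => (1 + δ k) ^ 2) atTop (𝓝 1) := by
    simpa using (hδ.const_add 1).pow 2
  simpa using ((((hδ'.mul_const _).const_mul c).add_const _).div_const 2)
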